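/- Let X ≥ 2 and Y ≥ 1, let H = H(X, Y, s, t) be a highland, and let L = 2(X + Y) + X⁴ + X² + X − 1. Let C ⊆ E(H) be an L-bounded cut between s and t in H with |C| ≤ X⁴ + X² + X. Then there exist indices i and j with 1 ≤ i ≤ X and X + 1 ≤ j ≤ X + Y such that C consists precisely of one edge from each shortcut of the low butte B_i together with one edge from each shortcut of the high butte B_j (so C ridges exactly the two buttes B_i and B_j and contains no other edges), and moreover h(B_j) = X⁴ + X − i. -/

import Mathlib

/-- Vertices of a chain of `Z` buttes concatenated in series, where the `b`-th butte has
height `hh b` and `Q` ridgeways. `junc m` is the `m`-th junction vertex (`junc 0` is the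
global source `s`, `junc Z` is the global sink `t`, and `junc b`, `junc (b+1)` are the
endpoints of the `b`-th butte); `sc b c` is the midpoint of the `c`-th shortcut of the
`b`-th butte; `rw b q p` is the `p`-th internal vertex of the `q`-th ridgeway (a path of
length `hh b + 2`) of the `b`-th butte. -/
inductive ChainV (Z Q : ℕ) (hh : Fin Z → ℕ) : Type
  | junc : Fin (Z + 1) → ChainV Z Q hh
  | sc : (b : Fin Z) → Fin (hh b) → ChainV Z Q hh
  | rw : (b : Fin Z) → Fin Q → Fin (hh b + 1) → ChainV Z Q hh

/-- Generating relation for the edges of a chain of buttes. -/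
def chainRel (Z Q : ℕ) (hh : Fin Z → ℕ) : ChainV Z Q hh → ChainV Z Q hh → Prop
  | .junc m, .sc b _ => m = b.castSucc
  | .sc b _, .junc m => m = b.succ
  | .junc m, .rw b _ p => m = b.castSucc ∧ p.val = 0
  | .rw b _ p, .junc m => m = b.succ ∧ p.val = hh b
  | .rw b q p, .rw b' q' p' => b = b' ∧ q = q' ∧ p'.val = p.val + 1
  | _, _ => False

/-- The chain graph of `Z` buttes in series. -/
def chainGraph (Z Q : ℕ) (hh : Fin Z → ℕ) : SimpleGraph (ChainV Z Q hh) :=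
  SimpleGraph.fromRel (chainRel Z Q hh)

/-- Heights of the buttes of the highland `H(X, Y, s, t)`: the `i`-th low butte
(`1 ≤ i ≤ X`) has height `X² + i`, and the heights of the high buttes are given
by `hts` (admissible when they lie in `{X⁴, …, X⁴ + X − 1}`). -/
def highlandHeights (X Y : ℕ) (hts : Fin Y → ℕ) : Fin (X + Y) → ℕ := fun b =>
  if h : b.val < X then X ^ 2 + b.val + 1 else hts ⟨b.val - X, by omega⟩

/-- The highland `H(X, Y, s, t)`: `X` low buttes followed by `Y` high buttes concatenated
in series, every butte having `Q = X⁴ + X²` ridgeways; `s` is `junc 0` and `t` is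
`junc (X + Y)`. -/
def highland (X Y : ℕ) (hts : Fin Y → ℕ) :
    SimpleGraph (ChainV (X + Y) (X ^ 4 + X ^ 2) (highlandHeights X Y hts)) :=
  chainGraph (X + Y) (X ^ 4 + X ^ 2) (highlandHeights X Y hts)

/-- `e` is an edge of a shortcut of the `b`-th butte of the chain. -/
def IsShortcutEdge {Z Q : ℕ} {hh : Fin Z → ℕ} (b : Fin Z) (e : Sym2 (ChainV Z Q hh)) :
    Prop :=
  ∃ c : Fin (hh b),
    e = s(ChainV.junc b.castSucc, ChainV.sc b c) ∨ e = s(ChainV.sc b c, ChainV.junc b.succ)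

/-- `C` contains exactly one edge from each shortcut of the `b`-th butte
(so `C` ridges the butte `b`). -/
def Ridges {Z Q : ℕ} {hh : Fin Z → ℕ} (C : Set (Sym2 (ChainV Z Q hh))) (b : Fin Z) :
    Prop :=
  ∀ c : Fin (hh b),
    (s(ChainV.junc b.castSucc, ChainV.sc b c) ∈ C ∧
        s(ChainV.sc b c, ChainV.junc b.succ) ∉ C) ∨
    (s(ChainV.junc b.castSucc, ChainV.sc b c) ∉ C ∧
        s(ChainV.sc b c, ChainV.junc b.succ) ∈ C)

open Finset

/-- The edge distance between the ends of a sequence of vertices is at most the sum of the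
distances between consecutive ones. -/
theorem SimpleGraph.edist_le_sum_edist {V : Type*} (G : SimpleGraph V) :
    ∀ (n : ℕ) (f : Fin (n + 1) → V),
      G.edist (f 0) (f (Fin.last n)) ≤ ∑ i : Fin n, G.edist (f i.castSucc) (f i.succ)
  | 0, f => by simp
  | n + 1, f => by
    rw [Fin.sum_univ_castSucc]
    exact (SimpleGraph.edist_triangle (v := f (Fin.last n).castSucc)).trans
      (add_le_add_left (SimpleGraph.edist_le_sum_edist G n fun i => f i.castSucc) _)

theorem SimpleGraph.edist_le_one_of_adj {V : Type*} {G : SimpleGraph V} {u v : V}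
    (h : G.Adj u v) : G.edist u v ≤ 1 :=
  (SimpleGraph.edist_eq_one_iff_adj.2 h).le

namespace ChainV

variable {Z Q : ℕ} {hh : Fin Z → ℕ}

/-- The shortcuts (left) and ridgeways (right) of a chain of buttes. -/
abbrev PathIndex (Z Q : ℕ) (hh : Fin Z → ℕ) : Type :=
  (Σ b : Fin Z, Fin (hh b)) ⊕ (Fin Z × Fin Q)

/-- The shortcut or ridgeway a vertex is internal to, if any. -/
def pathOf : ChainV Z Q hh → Option (PathIndex Z Q hh)
  | .junc _ => none
  | .sc b c => some (.inl ⟨b, c⟩)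
  | .rw b q _ => some (.inr (b, q))

/-- The edge `e` has an end that is internal to the path `π`. -/
def OnPath (π : PathIndex Z Q hh) (e : Sym2 (ChainV Z Q hh)) : Prop :=
  ∃ v ∈ e, v.pathOf = some π

instance : Nonempty (Sym2 (ChainV Z Q hh)) := ⟨s(junc 0, junc 0)⟩

instance : Finite (ChainV Z Q hh) := by
  let g : Fin (Z + 1) ⊕ (Σ b : Fin Z, Fin (hh b)) ⊕ (Σ b : Fin Z, Fin Q × Fin (hh b + 1)) →
      ChainV Z Q hh :=
    Sum.elim junc (Sum.elim (fun x => sc x.1 x.2) fun x => rw x.1 x.2.1 x.2.2)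
  refine Finite.of_surjective g ?_
  rintro (m | ⟨b, c⟩ | ⟨b, q, p⟩)
  · exact ⟨.inl m, rfl⟩
  · exact ⟨.inr (.inl ⟨b, c⟩), rfl⟩
  · exact ⟨.inr (.inr ⟨b, q, p⟩), rfl⟩

theorem pathOf_eq_of_chainRel {u v : ChainV Z Q hh} (h : chainRel Z Q hh u v)
    {π ρ : PathIndex Z Q hh} (hu : u.pathOf = some π) (hv : v.pathOf = some ρ) : π = ρ := by
  cases u <;> cases v <;> simp_all [chainRel, pathOf]

theorem OnPath.unique {e : Sym2 (ChainV Z Q hh)} (he : e ∈ (chainGraph Z Q hh).edgeSet)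
    {π ρ : PathIndex Z Q hh} (h : OnPath π e) (h' : OnPath ρ e) : π = ρ := by
  induction e with
  | _ u v =>
    obtain ⟨x, hx, hxπ⟩ := h
    obtain ⟨y, hy, hyρ⟩ := h'
    rw [SimpleGraph.mem_edgeSet, chainGraph, SimpleGraph.fromRel_adj] at he
    rw [Sym2.mem_iff] at hx hy
    rcases hx with rfl | rfl <;> rcases hy with rfl | rfl
    · exact Option.some.inj (hxπ.symm.trans hyρ)
    · rcases he.2 with h | h
      · exact pathOf_eq_of_chainRel h hxπ hyρ
      · exact (pathOf_eq_of_chainRel h hyρ hxπ).symm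
    · rcases he.2 with h | h
      · exact (pathOf_eq_of_chainRel h hyρ hxπ).symm
      · exact pathOf_eq_of_chainRel h hxπ hyρ
    · exact Option.some.inj (hxπ.symm.trans hyρ)

theorem OnPath.eq_or_eq {e : Sym2 (ChainV Z Q hh)} (he : e ∈ (chainGraph Z Q hh).edgeSet)
    {b : Fin Z} {c : Fin (hh b)} (h : OnPath (.inl ⟨b, c⟩) e) :
    e = s(junc b.castSucc, sc b c) ∨ e = s(sc b c, junc b.succ) := by
  obtain ⟨x, hx, hxπ⟩ := h
  obtain ⟨y, rfl⟩ := Sym2.mem_iff_exists.1 hx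
  have hxs : x = sc b c := by
    cases x <;> simp [pathOf] at hxπ
    obtain ⟨rfl, h⟩ := hxπ
    rw [eq_of_heq h]
  subst hxs
  rw [SimpleGraph.mem_edgeSet, chainGraph, SimpleGraph.fromRel_adj] at he
  rcases he.2 with h | h
  · cases y <;> simp [chainRel] at h
    subst h
    exact .inr rfl
  · cases y <;> simp [chainRel] at h
    subst h
    exact .inl Sym2.eq_swap

variable {C : Set (Sym2 (ChainV Z Q hh))}

/-- The path `π` loses an edge when `C` is deleted. -/
def IsCut (C : Set (Sym2 (ChainV Z Q hh))) (π : PathIndex Z Q hh) : Prop :=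
  ∃ e ∈ C, OnPath π e

theorem edist_le_one_of_chainRel {u v : ChainV Z Q hh} (h : chainRel Z Q hh u v) (hne : u ≠ v)
    {π : PathIndex Z Q hh} (hπ : ¬ IsCut C π) (huv : u.pathOf = some π ∨ v.pathOf = some π) :
    ((chainGraph Z Q hh).deleteEdges C).edist u v ≤ 1 := by
  apply SimpleGraph.edist_le_one_of_adj
  rw [SimpleGraph.deleteEdges_adj, chainGraph, SimpleGraph.fromRel_adj]
  refine ⟨⟨hne, .inl h⟩, fun hC => hπ ⟨_, hC, ?_⟩⟩
  rcases huv with h | h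
  · exact ⟨u, Sym2.mem_mk_left u v, h⟩
  · exact ⟨v, Sym2.mem_mk_right u v, h⟩

theorem edist_le_of_shortcut {b : Fin Z} {c : Fin (hh b)} (h : ¬ IsCut C (.inl ⟨b, c⟩)) :
    ((chainGraph Z Q hh).deleteEdges C).edist (junc b.castSucc) (junc b.succ) ≤ 2 := by
  refine (SimpleGraph.edist_triangle (v := sc b c)).trans ?_
  rw [← one_add_one_eq_two]
  exact add_le_add
    (edist_le_one_of_chainRel (by simp [chainRel]) (by simp) h (.inr rfl))
    (edist_le_one_of_chainRel (by simp [chainRel]) (by simp) h (.inl rfl))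

theorem edist_le_of_ridgeway {b : Fin Z} {q : Fin Q} (h : ¬ IsCut C (.inr (b, q))) :
    ((chainGraph Z Q hh).deleteEdges C).edist (junc b.castSucc) (junc b.succ) ≤
      (2 + hh b : ℕ) := by
  have inner : ((chainGraph Z Q hh).deleteEdges C).edist (rw b q 0) (rw b q (Fin.last _)) ≤
      (hh b : ℕ) := by
    refine (SimpleGraph.edist_le_sum_edist _ (hh b) (rw b q)).trans ?_
    refine (Finset.sum_le_card_nsmul _ _ 1 fun p _ => ?_).trans (by simp)
    exact edist_le_one_of_chainRel (by simp [chainRel]) (by simp [Fin.ext_iff]) h (.inl rfl)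
  have first : ((chainGraph Z Q hh).deleteEdges C).edist (junc b.castSucc) (rw b q 0) ≤ 1 :=
    edist_le_one_of_chainRel (by simp [chainRel]) (by simp) h (.inr rfl)
  have last : ((chainGraph Z Q hh).deleteEdges C).edist (rw b q (Fin.last _)) (junc b.succ) ≤ 1 :=
    edist_le_one_of_chainRel (by simp [chainRel]) (by simp) h (.inl rfl)
  calc _ ≤ _ := SimpleGraph.edist_triangle (v := rw b q 0)
    _ ≤ _ := add_le_add_right (SimpleGraph.edist_triangle (v := rw b q (Fin.last _))) _
    _ ≤ 1 + ((hh b : ℕ) + 1) := add_le_add first (add_le_add inner last)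
    _ = (2 + hh b : ℕ) := by push_cast; ring

/-- A set of edges meets at most as many paths as it has edges. -/
theorem card_le_ncard_of_isCut (hC : C ⊆ (chainGraph Z Q hh).edgeSet)
    (A : Finset (PathIndex Z Q hh)) (hA : ∀ π ∈ A, IsCut C π) : #A ≤ C.ncard := by
  choose! f hfC hf using hA
  rw [← Set.ncard_coe_finset]
  refine Set.ncard_le_ncard_of_injOn f hfC (fun π hπ ρ hρ h => ?_) C.toFinite
  exact (hf π hπ).unique (hC (hfC π hπ)) (h ▸ hf ρ hρ)

/-- If a set of edges meets exactly as many paths as it has edges, then each of its edges lies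
on one of these paths, and no two of them lie on the same path. -/
theorem exists_onPath_of_ncard_le (hC : C ⊆ (chainGraph Z Q hh).edgeSet)
    (A : Finset (PathIndex Z Q hh)) (hA : ∀ π ∈ A, IsCut C π) (hcard : C.ncard ≤ #A) :
    (∀ e ∈ C, ∃ π ∈ A, OnPath π e) ∧
      ∀ π, ∀ e ∈ C, ∀ e' ∈ C, OnPath π e → OnPath π e' → e = e' := by
  choose! f hfC hf using hA
  have hinj : Set.InjOn f A := fun π hπ ρ hρ h =>
    (hf π hπ).unique (hC (hfC π hπ)) (h ▸ hf ρ hρ)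
  have himage : f '' A = C := by
    refine Set.eq_of_subset_of_ncard_le (Set.image_subset_iff.2 hfC) ?_ C.toFinite
    rwa [hinj.ncard_image, Set.ncard_coe_finset]
  have hsurj : ∀ e ∈ C, ∃ π ∈ A, f π = e := fun e he => himage.superset he
  refine ⟨fun e he => ?_, fun π e he e' he' h h' => ?_⟩
  · obtain ⟨π, hπ, rfl⟩ := hsurj e he
    exact ⟨π, hπ, hf π hπ⟩
  · obtain ⟨ρ, hρ, rfl⟩ := hsurj e he
    obtain ⟨σ, hσ, rfl⟩ := hsurj e' he'
    rw [(hf ρ hρ).unique (hC he) h, (hf σ hσ).unique (hC he') h']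

theorem ridges_of_isCut (hC : C ⊆ (chainGraph Z Q hh).edgeSet)
    (huniq : ∀ π, ∀ e ∈ C, ∀ e' ∈ C, OnPath π e → OnPath π e' → e = e')
    {b : Fin Z} (hb : ∀ c : Fin (hh b), IsCut C (.inl ⟨b, c⟩)) : Ridges C b := by
  intro c
  have hne : s(junc b.castSucc, sc b c) ∈ C → s(sc b c, junc b.succ) ∈ C → False := by
    intro h h'
    have := huniq (.inl ⟨b, c⟩) _ h _ h' ⟨sc b c, by simp, rfl⟩ ⟨sc b c, by simp, rfl⟩
    simp [Fin.ext_iff] at this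
  obtain ⟨e, he, hp⟩ := hb c
  rcases hp.eq_or_eq (hC he) with rfl | rfl
  · exact .inl ⟨he, fun h => hne he h⟩
  · exact .inr ⟨fun h => hne h he, he⟩

/-- In a chain of buttes from which too few edges are deleted to cut all paths of a butte, the
distance between the ends grows by at most the heights of the buttes all of whose shortcuts are
cut. -/
theorem edist_ends_le (T : Finset (Fin Z)) (hT : ∀ b ∉ T, ∃ c, ¬ IsCut C (.inl ⟨b, c⟩))
    (hR : ∀ b ∈ T, ∃ q, ¬ IsCut C (.inr (b, q))) :
    ((chainGraph Z Q hh).deleteEdges C).edist (junc 0) (junc (Fin.last Z)) ≤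
      (2 * Z + ∑ b ∈ T, hh b : ℕ) := by
  classical
  calc _ ≤ _ := SimpleGraph.edist_le_sum_edist _ Z junc
    _ ≤ ∑ b : Fin Z, ((2 + if b ∈ T then hh b else 0 : ℕ) : ℕ∞) := by
      refine Finset.sum_le_sum fun b _ => ?_
      by_cases hb : b ∈ T
      · obtain ⟨q, hq⟩ := hR b hb
        simpa [hb] using edist_le_of_ridgeway hq
      · obtain ⟨c, hc⟩ := hT b hb
        simpa [hb] using edist_le_of_shortcut hc
    _ = (2 * Z + ∑ b ∈ T, hh b : ℕ) := by
      rw [← Nat.cast_sum, Finset.sum_add_distrib]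
      simp [mul_comm]

end ChainV

theorem highlandHeights_of_lt {X Y : ℕ} {hts : Fin Y → ℕ} {b : Fin (X + Y)} (h : b.val < X) :
    highlandHeights X Y hts b = X ^ 2 + b.val + 1 := by
  simp [highlandHeights, h]

theorem highlandHeights_of_ge {X Y : ℕ} {hts : Fin Y → ℕ}
    (hhts : ∀ y : Fin Y, X ^ 4 ≤ hts y ∧ hts y ≤ X ^ 4 + X - 1) {b : Fin (X + Y)}
    (h : X ≤ b.val) :
    X ^ 4 ≤ highlandHeights X Y hts b ∧ highlandHeights X Y hts b ≤ X ^ 4 + X - 1 := by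
  simp only [highlandHeights, not_lt.2 h, dite_false]
  exact hhts _

theorem sq_lt_highlandHeights {X Y : ℕ} (hX : 2 ≤ X) {hts : Fin Y → ℕ}
    (hhts : ∀ y : Fin Y, X ^ 4 ≤ hts y ∧ hts y ≤ X ^ 4 + X - 1) (b : Fin (X + Y)) :
    X ^ 2 < highlandHeights X Y hts b := by
  by_cases h : b.val < X
  · rw [highlandHeights_of_lt h]
    omega
  · exact (Nat.pow_lt_pow_right hX (by norm_num)).trans_le
      (highlandHeights_of_ge hhts (not_lt.1 h)).1

/-- A set of buttes of a highland with total height `X⁴ + X² + X` consists of one low and one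
high butte. -/
theorem exists_eq_pair_of_sum_highlandHeights {X Y : ℕ} (hX : 2 ≤ X) {hts : Fin Y → ℕ}
    (hhts : ∀ y : Fin Y, X ^ 4 ≤ hts y ∧ hts y ≤ X ^ 4 + X - 1) (T : Finset (Fin (X + Y)))
    (hT : ∑ b ∈ T, highlandHeights X Y hts b = X ^ 4 + X ^ 2 + X) :
    ∃ i j : Fin (X + Y), i.val < X ∧ X ≤ j.val ∧ T = {i, j} ∧
      highlandHeights X Y hts j = X ^ 4 + X - (i.val + 1) := by
  have hXsq : 2 * X ≤ X ^ 2 := by nlinarith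
  have hXfour : 4 * X ^ 2 ≤ X ^ 4 := by nlinarith [Nat.pow_le_pow_left hX 2]
  obtain ⟨j, hjT, hj⟩ : ∃ j ∈ T, X ≤ j.val := by
    by_contra! hlow
    have hcard : #T ≤ X := by
      rw [← Finset.card_map Fin.valEmbedding]
      refine (Finset.card_le_card (t := Finset.range X) fun k hk => ?_).trans_eq
        (Finset.card_range X)
      obtain ⟨b, hb, rfl⟩ := Finset.mem_map.1 hk
      exact Finset.mem_range.2 (hlow b hb)
    have hsum := Finset.sum_le_card_nsmul T (highlandHeights X Y hts) (X ^ 2 + X) fun b hb => by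
      have := hlow b hb
      rw [highlandHeights_of_lt this]
      omega
    have : #T * (X ^ 2 + X) ≤ X * (X ^ 2 + X) := Nat.mul_le_mul_right _ hcard
    have : 2 * X ^ 3 ≤ X ^ 4 := by
      rw [pow_succ X 3, mul_comm]
      exact Nat.mul_le_mul_left _ hX
    rw [hT, smul_eq_mul] at hsum
    nlinarith
  have hjh := highlandHeights_of_ge hhts hj
  rw [← Finset.add_sum_erase T _ hjT] at hT
  obtain ⟨i, hiT⟩ : (T.erase j).Nonempty := by
    by_contra! hempty
    rw [hempty, Finset.sum_empty] at hT
    omega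
  rw [← Finset.add_sum_erase _ _ hiT] at hT
  have hi : i.val < X := by
    by_contra! hi
    have := highlandHeights_of_ge hhts hi
    omega
  have hempty : (T.erase j).erase i = ∅ := by
    by_contra! hne
    obtain ⟨k, hk⟩ := hne
    rw [← Finset.add_sum_erase _ _ hk] at hT
    have := sq_lt_highlandHeights hX hhts k
    have := sq_lt_highlandHeights hX hhts i
    omega
  refine ⟨i, j, hi, hj, ?_, ?_⟩
  · rw [← Finset.insert_erase hjT, ← Finset.insert_erase hiT, hempty, Finset.pair_comm]
    simp
  · rw [hempty, Finset.sum_empty, highlandHeights_of_lt hi] at hT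
    omega

/-- Let `X ≥ 2`, `Y ≥ 1`, `H = H(X, Y, s, t)` a highland and
`L = 2(X + Y) + X⁴ + X² + X − 1`. If `C` is an `L`-bounded cut between `s` and `t` in `H`
with `|C| ≤ X⁴ + X² + X`, then there are a low butte `B_i` and a high butte `B_j` such
that `C` consists precisely of one edge from each shortcut of `B_i` together with one edge
from each shortcut of `B_j`, and `h(B_j) = X⁴ + X − i` (where `i` is the 1-based index of
the low butte, whose height is `X² + i`). -/
theorem highland_cut_structure (X Y : ℕ) (hX : 2 ≤ X) (hY : 1 ≤ Y) (hts : Fin Y → ℕ)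
    (hhts : ∀ y : Fin Y, X ^ 4 ≤ hts y ∧ hts y ≤ X ^ 4 + X - 1)
    (L : ℕ) (hL : L = 2 * (X + Y) + X ^ 4 + X ^ 2 + X - 1)
    (C : Set (Sym2 (ChainV (X + Y) (X ^ 4 + X ^ 2) (highlandHeights X Y hts))))
    (hCsub : C ⊆ (highland X Y hts).edgeSet)
    (hcut : (L + 1 : ℕ∞) ≤
      ((highland X Y hts).deleteEdges C).edist (ChainV.junc 0)
        (ChainV.junc (Fin.last (X + Y))))
    (hsize : C.ncard ≤ X ^ 4 + X ^ 2 + X) :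
    ∃ i j : Fin (X + Y), i.val < X ∧ X ≤ j.val ∧
      Ridges C i ∧ Ridges C j ∧
      (∀ e ∈ C, IsShortcutEdge i e ∨ IsShortcutEdge j e) ∧
      highlandHeights X Y hts j = X ^ 4 + X - (i.val + 1) := by
  classical
  change C ⊆ (chainGraph _ _ _).edgeSet at hCsub
  let T : Finset (Fin (X + Y)) := {b | ∀ c : Fin _, ChainV.IsCut C (.inl ⟨b, c⟩)}
  have hTmem : ∀ b, b ∈ T ↔ ∀ c : Fin _, ChainV.IsCut C (.inl ⟨b, c⟩) := by simp [T]
  have hR : ∀ b ∈ T, ∃ q, ¬ ChainV.IsCut C (.inr (b, q)) := by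
    intro b hb
    by_contra! hall
    have hcard := ChainV.card_le_ncard_of_isCut hCsub
      ((({b} : Finset (Fin (X + Y))).sigma fun _ => univ).disjSum
        ({b} ×ˢ univ)) (by
        rintro (⟨b', c⟩ | ⟨b', q⟩) h
        · obtain rfl : b' = b := by simpa using h
          exact (hTmem b').1 hb c
        · obtain rfl : b' = b := by simpa [eq_comm] using h
          exact hall q)
    rw [Finset.card_disjSum, Finset.card_sigma, Finset.card_product] at hcard
    simp only [Finset.sum_singleton, Finset.card_univ, Fintype.card_fin, Finset.card_singleton,
      one_mul] at hcard
    have hb' : X ^ 2 < highlandHeights X Y hts b := sq_lt_highlandHeights hX hhts b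
    nlinarith
  have hdist := hcut.trans (ChainV.edist_ends_le T (fun b hb => by
    simpa [hTmem] using hb) hR)
  have hlow : L + 1 ≤ 2 * (X + Y) + ∑ b ∈ T, highlandHeights X Y hts b := by exact_mod_cast hdist
  let A : Finset (ChainV.PathIndex (X + Y) (X ^ 4 + X ^ 2) (highlandHeights X Y hts)) :=
    (T.sigma fun _ => univ).disjSum ∅
  have hA : ∀ π ∈ A, ChainV.IsCut C π := by
    rintro (⟨b, c⟩ | ⟨b, q⟩) h
    · exact (hTmem b).1 (by simpa [A] using h) c
    · simp [A] at h
  have hAcard : #A = ∑ b ∈ T, highlandHeights X Y hts b := by simp [A]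
  have hup := ChainV.card_le_ncard_of_isCut hCsub A hA
  obtain ⟨hmem, huniq⟩ := ChainV.exists_onPath_of_ncard_le hCsub A hA (by omega)
  obtain ⟨i, j, hi, hj, hTij, hheight⟩ :=
    exists_eq_pair_of_sum_highlandHeights hX hhts T (by omega)
  refine ⟨i, j, hi, hj, ChainV.ridges_of_isCut hCsub huniq ((hTmem i).1 (by simp [hTij])),
    ChainV.ridges_of_isCut hCsub huniq ((hTmem j).1 (by simp [hTij])), fun e he => ?_, hheight⟩
  obtain ⟨⟨b, c⟩ | ⟨b, q⟩, hπ, hp⟩ := hmem e he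
  · have hb : b = i ∨ b = j := by simpa [A, hTij] using hπ
    have hedge : IsShortcutEdge b e := ⟨c, hp.eq_or_eq (hCsub he)⟩
    rcases hb with rfl | rfl
    · exact .inl hedge
    · exact .inr hedge
  · simp [A] at hπ
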